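/- Let H = N⋊T be the smash product of cocommutative Hopf algebras N and T over a field k, acting trivially on the commutative k-algebra A, and let f: H⊗H → A be a normalized Sweedler 2-cocycle. Then for all n,n' ∈ N, t,t' ∈ T and h,h' ∈ H: (1) f(nt⊗h') = ∑ f(t_(1)⊗h'_(1)) f(n⊗t_(2)h'_(2)); (2) f(nt⊗t') = ε(n) f(t⊗t'); (3) f(h⊗n't') = ∑ f(h_(1)⊗n'_(1)) f(h_(2)n'_(2)⊗t'); (4) f(n⊗n't') = f(n⊗n') ε(t'); (5) f(nt⊗n't') = ∑ f(t_(1)⊗t') f(t_(2)⊗n'_(1)) f(n⊗t_(3)(n'_(2))). -/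

import Mathlib

open TensorProduct

namespace SmashPaper

variable (k : Type) [Field k]

section Conv

variable {k : Type} [Field k] {C A : Type} [AddCommGroup C] [Module k C] [Coalgebra k C]
  [CommRing A] [Algebra k A]

/-- Convolution product on linear maps from a coalgebra to an algebra. -/
noncomputable def conv (f g : C →ₗ[k] A) : C →ₗ[k] A :=
  LinearMap.mul' k A ∘ₗ TensorProduct.map f g ∘ₗ Coalgebra.comul

/-- Convolution unit. -/
noncomputable def convOne (C A : Type) [AddCommGroup C] [Module k C] [Coalgebra k C]
    [CommRing A] [Algebra k A] : C →ₗ[k] A :=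
  Algebra.linearMap k A ∘ₗ Coalgebra.counit

def IsConvInv (f g : C →ₗ[k] A) : Prop :=
  conv f g = convOne C A ∧ conv g f = convOne C A

def IsConvInvertible (f : C →ₗ[k] A) : Prop := ∃ g, IsConvInv f g

end Conv

/-- Cocommutativity of a coalgebra. -/
def IsCocomm (C : Type) [AddCommGroup C] [Module k C] [Coalgebra k C] : Prop :=
  (TensorProduct.comm k C C).toLinearMap ∘ₗ Coalgebra.comul
    = (Coalgebra.comul : C →ₗ[k] C ⊗[k] C)

section Drop

variable {k : Type} [Field k] (C D : Type) [AddCommGroup C] [Module k C]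
  [AddCommGroup D] [Module k D]

/-- `c ⊗ d ↦ ε(c) d`. -/
noncomputable def dropL [Coalgebra k C] : C ⊗[k] D →ₗ[k] D :=
  (TensorProduct.lid k D).toLinearMap ∘ₗ LinearMap.rTensor D (Coalgebra.counit (R := k))

/-- `c ⊗ d ↦ ε(d) c`. -/
noncomputable def dropR [Coalgebra k D] : C ⊗[k] D →ₗ[k] C :=
  (TensorProduct.rid k C).toLinearMap ∘ₗ LinearMap.lTensor C (Coalgebra.counit (R := k))

end Drop

section Sweedler

variable {k : Type} [Field k] (H A : Type) [Ring H] [Bialgebra k H]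
  [CommRing A] [Algebra k A]

variable {H A}

/-- Normalization for 1-cochains. -/
def Normalized1 (t : H →ₗ[k] A) : Prop := t 1 = 1

/-- Normalization for 2-cochains: trivial whenever an argument is a scalar. -/
def Normalized2 (f : H ⊗[k] H →ₗ[k] A) : Prop :=
  ∀ x : H, f (1 ⊗ₜ[k] x) = algebraMap k A (Coalgebra.counit x)
    ∧ f (x ⊗ₜ[k] 1) = algebraMap k A (Coalgebra.counit x)

/-- Normalization for 3-cochains. -/
def Normalized3 (f : (H ⊗[k] H) ⊗[k] H →ₗ[k] A) : Prop :=
  ∀ x y : H,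
    f ((1 ⊗ₜ[k] x) ⊗ₜ[k] y) = algebraMap k A (Coalgebra.counit x * Coalgebra.counit y)
    ∧ f ((x ⊗ₜ[k] 1) ⊗ₜ[k] y) = algebraMap k A (Coalgebra.counit x * Coalgebra.counit y)
    ∧ f ((x ⊗ₜ[k] y) ⊗ₜ[k] 1) = algebraMap k A (Coalgebra.counit x * Coalgebra.counit y)

/-- `∑ f(x₍₁₎ ⊗ y₍₁₎) f(x₍₂₎y₍₂₎ ⊗ z)` as a linear map on `(H ⊗ H) ⊗ H`. -/
noncomputable def cocycle2LHS (f : H ⊗[k] H →ₗ[k] A) : (H ⊗[k] H) ⊗[k] H →ₗ[k] A :=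
  conv (f ∘ₗ dropR (H ⊗[k] H) H) (f ∘ₗ LinearMap.rTensor H (LinearMap.mul' k H))

/-- `∑ f(y₍₁₎ ⊗ z₍₁₎) f(x ⊗ y₍₂₎z₍₂₎)` as a linear map on `(H ⊗ H) ⊗ H`. -/
noncomputable def cocycle2RHS (f : H ⊗[k] H →ₗ[k] A) : (H ⊗[k] H) ⊗[k] H →ₗ[k] A :=
  conv (f ∘ₗ dropL H (H ⊗[k] H) ∘ₗ (TensorProduct.assoc k H H H).toLinearMap)
       (f ∘ₗ LinearMap.lTensor H (LinearMap.mul' k H) ∘ₗ (TensorProduct.assoc k H H H).toLinearMap)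

/-- Sweedler 2-cocycles (for the trivial action). -/
def IsZ2 (f : H ⊗[k] H →ₗ[k] A) : Prop :=
  Normalized2 f ∧ IsConvInvertible f ∧ cocycle2LHS f = cocycle2RHS f

/-- The Sweedler 2-coboundary `∑ t(y₍₁₎) t⁻¹(x₍₁₎y₍₂₎) t(x₍₂₎)` of a 1-cochain `t`
with convolution inverse `tinv`. -/
noncomputable def cobound2 (t tinv : H →ₗ[k] A) : H ⊗[k] H →ₗ[k] A :=
  conv (t ∘ₗ dropL H H) (conv (tinv ∘ₗ LinearMap.mul' k H) (t ∘ₗ dropR H H))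

/-- Sweedler 2-coboundaries (for the trivial action). -/
def IsB2 (f : H ⊗[k] H →ₗ[k] A) : Prop :=
  ∃ t tinv : H →ₗ[k] A, Normalized1 t ∧ IsConvInv t tinv ∧ f = cobound2 t tinv

/-- Two 2-cochains are cohomologous when they differ (in convolution) by a 2-coboundary. -/
def Cohomologous2 (f f' : H ⊗[k] H →ₗ[k] A) : Prop :=
  ∃ b, IsB2 b ∧ f = conv f' b

/-- `(x⊗y)⊗z ↦ x ⊗ yz`. -/
noncomputable def m23 : (H ⊗[k] H) ⊗[k] H →ₗ[k] H ⊗[k] H :=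
  LinearMap.lTensor H (LinearMap.mul' k H) ∘ₗ (TensorProduct.assoc k H H H).toLinearMap

/-- `(x⊗y)⊗z ↦ ε(x) (y⊗z)`. -/
noncomputable def p23 : (H ⊗[k] H) ⊗[k] H →ₗ[k] H ⊗[k] H :=
  dropL H (H ⊗[k] H) ∘ₗ (TensorProduct.assoc k H H H).toLinearMap

/-- 3-cocycle condition
`∑ f(y₁⊗z₁⊗w₁) f(x₁⊗y₂z₂⊗w₂) f(x₂⊗y₃⊗z₃) = ∑ f(x₁y₁⊗z₁⊗w₁) f(x₂⊗y₂⊗z₂w₂)`. -/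
def IsZ3cond (f : (H ⊗[k] H) ⊗[k] H →ₗ[k] A) : Prop :=
  conv (f ∘ₗ LinearMap.rTensor H (LinearMap.rTensor H (dropL H H)))
    (conv (f ∘ₗ LinearMap.rTensor H (m23 (H := H)))
          (f ∘ₗ dropR ((H ⊗[k] H) ⊗[k] H) H))
  = conv (C := ((H ⊗[k] H) ⊗[k] H) ⊗[k] H)
         (f ∘ₗ LinearMap.rTensor H (LinearMap.rTensor H (LinearMap.mul' k H)))
         (f ∘ₗ (LinearMap.lTensor (H ⊗[k] H) (LinearMap.mul' k H)
              ∘ₗ (TensorProduct.assoc k (H ⊗[k] H) H H).toLinearMap :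
                ((H ⊗[k] H) ⊗[k] H) ⊗[k] H →ₗ[k] (H ⊗[k] H) ⊗[k] H))

/-- Sweedler 3-cocycles (for the trivial action). -/
def IsZ3 (f : (H ⊗[k] H) ⊗[k] H →ₗ[k] A) : Prop :=
  Normalized3 f ∧ IsConvInvertible f ∧ IsZ3cond f

/-- The Sweedler 3-coboundary
`∑ v(y₁⊗z₁) v⁻¹(x₁y₂⊗z₂) v(x₂⊗y₃z₃) v⁻¹(x₃⊗y₄)` of a 2-cochain `v`. -/
noncomputable def cobound3 (v vinv : H ⊗[k] H →ₗ[k] A) : (H ⊗[k] H) ⊗[k] H →ₗ[k] A :=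
  conv (v ∘ₗ p23 (H := H))
    (conv (vinv ∘ₗ LinearMap.rTensor H (LinearMap.mul' k H))
      (conv (v ∘ₗ m23 (H := H)) (vinv ∘ₗ dropR (H ⊗[k] H) H)))

/-- Sweedler 3-coboundaries (for the trivial action). -/
def IsB3 (f : (H ⊗[k] H) ⊗[k] H →ₗ[k] A) : Prop :=
  ∃ v vinv : H ⊗[k] H →ₗ[k] A, Normalized2 v ∧ IsConvInv v vinv ∧ f = cobound3 v vinv

/-- Cohomologous 3-cochains. -/
def Cohomologous3 (f f' : (H ⊗[k] H) ⊗[k] H →ₗ[k] A) : Prop :=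
  ∃ b, IsB3 b ∧ f = conv f' b

end Sweedler

section Measuring

variable {k : Type} [Field k]
variable {C : Type} [AddCommGroup C] [Module k C] [Coalgebra k C]
variable {N : Type} [Ring N] [Bialgebra k N]
variable {A : Type} [CommRing A] [Algebra k A]

/-- `(C, θ)` measures `N` to `A`:
`∑ θ(c₍₁₎ ⊗ n) θ(c₍₂₎ ⊗ n') = θ(c ⊗ nn')` and `θ(c ⊗ 1) = ε(c) 1`. -/
def Measures (θ : C ⊗[k] N →ₗ[k] A) : Prop :=
  (θ ∘ₗ LinearMap.lTensor C (LinearMap.mul' k N)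
    = conv (θ ∘ₗ LinearMap.lTensor C (dropR N N)) (θ ∘ₗ LinearMap.lTensor C (dropL N N)))
  ∧ ∀ c : C, θ (c ⊗ₜ[k] (1 : N)) = algebraMap k A (Coalgebra.counit c)

end Measuring

section Action

variable {k : Type} [Field k]
variable {T N : Type} [Ring T] [Bialgebra k T] [Ring N] [Bialgebra k N]

/-- `μ : T ⊗ N → N` makes `N` a left `T`-module bialgebra. -/
structure IsModuleBialgebra (μ : T ⊗[k] N →ₗ[k] N) : Prop where
  one_act : ∀ n : N, μ ((1 : T) ⊗ₜ[k] n) = n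
  mul_act : ∀ (t s : T) (n : N), μ ((t * s) ⊗ₜ[k] n) = μ (t ⊗ₜ[k] μ (s ⊗ₜ[k] n))
  act_one : ∀ t : T, μ (t ⊗ₜ[k] (1 : N)) = algebraMap k N (Coalgebra.counit t)
  act_mul : μ ∘ₗ LinearMap.lTensor T (LinearMap.mul' k N)
      = LinearMap.mul' k N ∘ₗ TensorProduct.map μ μ
          ∘ₗ (TensorProduct.tensorTensorTensorComm k T T N N).toLinearMap
          ∘ₗ LinearMap.rTensor (N ⊗[k] N) Coalgebra.comul
  comul_act : Coalgebra.comul ∘ₗ μ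
      = TensorProduct.map μ μ
          ∘ₗ (TensorProduct.tensorTensorTensorComm k T T N N).toLinearMap
          ∘ₗ TensorProduct.map Coalgebra.comul Coalgebra.comul
  counit_act : ∀ (t : T) (n : N),
      Coalgebra.counit (R := k) (μ (t ⊗ₜ[k] n))
        = Coalgebra.counit (R := k) t * Coalgebra.counit (R := k) n

/-- `t ⊗ n ↦ ∑ t₍₁₎(n) ⊗ t₍₂₎`. -/
noncomputable def smashCross (μ : T ⊗[k] N →ₗ[k] N) : T ⊗[k] N →ₗ[k] N ⊗[k] T :=
  TensorProduct.map μ LinearMap.id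
    ∘ₗ (TensorProduct.assoc k T N T).symm.toLinearMap
    ∘ₗ LinearMap.lTensor T (TensorProduct.comm k T N).toLinearMap
    ∘ₗ (TensorProduct.assoc k T T N).toLinearMap
    ∘ₗ LinearMap.rTensor N Coalgebra.comul

variable {H : Type} [Ring H] [Bialgebra k H]

/-- `H` is the smash product `N ⋊ T` along the action `μ`, with `N` and `T` included
as the Hopf subalgebras `N ⋊ 1` and `1 ⋊ T`; we identify `n ⋊ t = n t`. -/
structure IsSmashProduct (μ : T ⊗[k] N →ₗ[k] N) (iN : N →ₐc[k] H) (iT : T →ₐc[k] H) : Prop where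
  act : IsModuleBialgebra μ
  injN : Function.Injective iN
  injT : Function.Injective iT
  /-- `n ⊗ t ↦ (n ⋊ 1)(1 ⋊ t)` is a linear isomorphism `N ⊗ T ≅ H` (`H` is the
  tensor product coalgebra `N ⊗ T`). -/
  bij : Function.Bijective
    (LinearMap.mul' k H ∘ₗ TensorProduct.map (iN : N →ₗ[k] H) (iT : T →ₗ[k] H))
  /-- The smash relation `t n = ∑ t₍₁₎(n) t₍₂₎` in `H`. -/
  straighten : LinearMap.mul' k H ∘ₗ TensorProduct.map (iT : T →ₗ[k] H) (iN : N →ₗ[k] H)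
      = LinearMap.mul' k H ∘ₗ TensorProduct.map (iN : N →ₗ[k] H) (iT : T →ₗ[k] H)
          ∘ₗ smashCross μ

end Action

section MeasCohomology

variable {k : Type} [Field k]
variable {T N : Type} [Ring T] [Bialgebra k T] [Ring N] [Bialgebra k N]
variable {A : Type} [CommRing A] [Algebra k A]

/-- Normalization in the `T`-variable for measuring 1-cochains `T ⊗ N → A`. -/
def MeasNormalized1 (f : T ⊗[k] N →ₗ[k] A) : Prop :=
  ∀ n : N, f ((1 : T) ⊗ₜ[k] n) = algebraMap k A (Coalgebra.counit n)

/-- A measuring 1-cochain: an element of `Reg_meas(T, Hom(N,A))`. -/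
def IsRegMeas1 (f : T ⊗[k] N →ₗ[k] A) : Prop :=
  Measures f ∧ MeasNormalized1 f ∧ IsConvInvertible f

/-- The measuring 1-cocycle condition `f(ts)(n) = ∑ f(s₍₁₎)(n₍₁₎) f(t)(s₍₂₎(n₍₂₎))`. -/
def MeasCocycle1 (μ : T ⊗[k] N →ₗ[k] N) (f : T ⊗[k] N →ₗ[k] A) : Prop :=
  f ∘ₗ LinearMap.rTensor N (LinearMap.mul' k T)
    = conv (f ∘ₗ LinearMap.rTensor N (dropL T T))
      (f ∘ₗ LinearMap.lTensor T μ ∘ₗ (TensorProduct.assoc k T T N).toLinearMap)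

/-- Measuring 1-cocycles. -/
def IsMeasZ1 (μ : T ⊗[k] N →ₗ[k] N) (f : T ⊗[k] N →ₗ[k] A) : Prop :=
  IsRegMeas1 f ∧ MeasCocycle1 μ f

/-- Measuring 1-coboundaries: `f(t)(n) = ∑ g(n₍₁₎) g⁻¹(t(n₍₂₎))` for a
convolution-invertible algebra map `g : N → A`. -/
def IsMeasB1 (μ : T ⊗[k] N →ₗ[k] N) (f : T ⊗[k] N →ₗ[k] A) : Prop :=
  ∃ (g : N →ₐ[k] A) (ginv : N →ₗ[k] A), IsConvInv g.toLinearMap ginv ∧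
    f = conv (g.toLinearMap ∘ₗ dropL T N) (ginv ∘ₗ μ)

/-- Normalization for measuring 2-cochains `(T ⊗ T) ⊗ N → A`. -/
def MeasNormalized2 (f : (T ⊗[k] T) ⊗[k] N →ₗ[k] A) : Prop :=
  ∀ (t : T) (n : N),
    f (((1 : T) ⊗ₜ[k] t) ⊗ₜ[k] n)
        = algebraMap k A (Coalgebra.counit t * Coalgebra.counit n)
    ∧ f ((t ⊗ₜ[k] (1 : T)) ⊗ₜ[k] n)
        = algebraMap k A (Coalgebra.counit t * Coalgebra.counit n)

/-- A measuring 2-cochain: an element of `Reg_meas(T ⊗ T, Hom(N,A))`. -/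
def IsRegMeas2 (f : (T ⊗[k] T) ⊗[k] N →ₗ[k] A) : Prop :=
  Measures f ∧ MeasNormalized2 f ∧ IsConvInvertible f

/-- The measuring 2-cocycle condition
`∑ f(t₍₁₎⊗s₍₁₎)(r₍₁₎(n₍₁₎)) f(t₍₂₎s₍₂₎⊗r₍₂₎)(n₍₂₎) = ∑ f(s₍₁₎⊗r₍₁₎)(n₍₁₎) f(t⊗s₍₂₎r₍₂₎)(n₍₂₎)`. -/
def MeasCocycle2 (μ : T ⊗[k] N →ₗ[k] N) (f : (T ⊗[k] T) ⊗[k] N →ₗ[k] A) : Prop :=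
  conv (C := ((T ⊗[k] T) ⊗[k] T) ⊗[k] N)
       (f ∘ₗ (LinearMap.lTensor (T ⊗[k] T) μ
          ∘ₗ (TensorProduct.assoc k (T ⊗[k] T) T N).toLinearMap :
            ((T ⊗[k] T) ⊗[k] T) ⊗[k] N →ₗ[k] (T ⊗[k] T) ⊗[k] N))
       (f ∘ₗ LinearMap.rTensor N (LinearMap.rTensor T (LinearMap.mul' k T)))
    = conv (C := ((T ⊗[k] T) ⊗[k] T) ⊗[k] N)
           (f ∘ₗ LinearMap.rTensor N (LinearMap.rTensor T (dropL T T)))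
           (f ∘ₗ LinearMap.rTensor N
              ((LinearMap.lTensor T (LinearMap.mul' k T)
                ∘ₗ (TensorProduct.assoc k T T T).toLinearMap :
                  (T ⊗[k] T) ⊗[k] T →ₗ[k] T ⊗[k] T)))

/-- Measuring 2-cocycles. -/
def IsMeasZ2 (μ : T ⊗[k] N →ₗ[k] N) (f : (T ⊗[k] T) ⊗[k] N →ₗ[k] A) : Prop :=
  IsRegMeas2 f ∧ MeasCocycle2 μ f

/-- The measuring coboundary
`(t ⊗ s ⊗ n) ↦ ∑ g(s₍₁₎)(n₍₁₎) g⁻¹(t₍₁₎s₍₂₎)(n₍₂₎) g(t₍₂₎)(s₍₃₎(n₍₃₎))`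
of a 1-cochain `g` with convolution inverse `ginv`.  (For a 2-cocycle `f` on `N` with
stability witness `g`, this same formula is the map `d`. ) -/
noncomputable def measCobound (μ : T ⊗[k] N →ₗ[k] N) (g ginv : T ⊗[k] N →ₗ[k] A) :
    (T ⊗[k] T) ⊗[k] N →ₗ[k] A :=
  conv (g ∘ₗ LinearMap.rTensor N (dropL T T))
    (conv (ginv ∘ₗ LinearMap.rTensor N (LinearMap.mul' k T))
          (g ∘ₗ LinearMap.lTensor T μ ∘ₗ (TensorProduct.assoc k T T N).toLinearMap))

/-- Measuring 2-coboundaries. -/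
def IsMeasB2 (μ : T ⊗[k] N →ₗ[k] N) (f : (T ⊗[k] T) ⊗[k] N →ₗ[k] A) : Prop :=
  ∃ g ginv : T ⊗[k] N →ₗ[k] A, IsRegMeas1 g ∧ IsConvInv g ginv ∧ f = measCobound μ g ginv

/-- Cohomologous measuring 2-cochains. -/
def MeasCohomologous2 (μ : T ⊗[k] N →ₗ[k] N) (f f' : (T ⊗[k] T) ⊗[k] N →ₗ[k] A) : Prop :=
  ∃ b, IsMeasB2 μ b ∧ f = conv f' b

/-- `∑ f(n₍₁₎ ⊗ n'₍₁₎) f⁻¹(t₍₁₎(n₍₂₎) ⊗ t₍₂₎(n'₍₂₎))` as a map `T ⊗ (N ⊗ N) → A`. -/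
noncomputable def stabLHS (μ : T ⊗[k] N →ₗ[k] N) (f finv : N ⊗[k] N →ₗ[k] A) :
    T ⊗[k] (N ⊗[k] N) →ₗ[k] A :=
  conv (f ∘ₗ dropL T (N ⊗[k] N))
       (finv ∘ₗ TensorProduct.map μ μ
          ∘ₗ (TensorProduct.tensorTensorTensorComm k T T N N).toLinearMap
          ∘ₗ LinearMap.rTensor (N ⊗[k] N) Coalgebra.comul)

/-- `∑ g(t₍₁₎ ⊗ n₍₁₎) g⁻¹(t₍₂₎ ⊗ n₍₂₎n'₍₁₎) g(t₍₃₎ ⊗ n'₍₂₎)` as a map `T ⊗ (N ⊗ N) → A`. -/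
noncomputable def stabRHS (g ginv : T ⊗[k] N →ₗ[k] A) : T ⊗[k] (N ⊗[k] N) →ₗ[k] A :=
  conv (g ∘ₗ LinearMap.lTensor T (dropR N N))
    (conv (ginv ∘ₗ LinearMap.lTensor T (LinearMap.mul' k N))
          (g ∘ₗ LinearMap.lTensor T (dropL N N)))

/-- `g` (with convolution inverse `ginv`) witnesses the `T`-stability of the
2-cochain `f` on `N` (with convolution inverse `finv`):
`f * (f⁻¹)ᵗ = δ'(g(t ⊗ _))`. -/
def IsStabilityWitness (μ : T ⊗[k] N →ₗ[k] N) (f finv : N ⊗[k] N →ₗ[k] A)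
    (g ginv : T ⊗[k] N →ₗ[k] A) : Prop :=
  MeasNormalized1 g ∧ (∀ t : T, g (t ⊗ₜ[k] (1 : N)) = algebraMap k A (Coalgebra.counit t))
    ∧ IsConvInv g ginv ∧ stabLHS μ f finv = stabRHS g ginv

/-- The cohomology class of the 2-cocycle `f` on `N` is `T`-stable. -/
def IsTStable (μ : T ⊗[k] N →ₗ[k] N) (f finv : N ⊗[k] N →ₗ[k] A) : Prop :=
  ∃ g ginv, IsStabilityWitness μ f finv g ginv

end MeasCohomology

section SmashStatements

variable {k : Type} [Field k]
variable {T N H A : Type} [Ring T] [Bialgebra k T] [Ring N] [Bialgebra k N]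
  [Ring H] [Bialgebra k H] [CommRing A] [Algebra k A]

/-- `n ⊗ t ↦ (n ⋊ 1)(1 ⋊ t) = n ⋊ t`. -/
noncomputable def smashMul (iN : N →ₐc[k] H) (iT : T →ₐc[k] H) : N ⊗[k] T →ₗ[k] H :=
  LinearMap.mul' k H ∘ₗ TensorProduct.map iN.toLinearMap iT.toLinearMap

/-- The restriction of a 2-cochain on `H` to `N ⊗ N`. -/
noncomputable def resNN (iN : N →ₐc[k] H) (f : H ⊗[k] H →ₗ[k] A) : N ⊗[k] N →ₗ[k] A :=
  f ∘ₗ TensorProduct.map iN.toLinearMap iN.toLinearMap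

/-- The restriction of a 2-cochain on `H` to `T ⊗ T`. -/
noncomputable def resTT (iT : T →ₐc[k] H) (f : H ⊗[k] H →ₗ[k] A) : T ⊗[k] T →ₗ[k] A :=
  f ∘ₗ TensorProduct.map iT.toLinearMap iT.toLinearMap

/-- The restriction of a 2-cochain on `H` to `T ⊗ N`. -/
noncomputable def resTN (iN : N →ₐc[k] H) (iT : T →ₐc[k] H) (f : H ⊗[k] H →ₗ[k] A) :
    T ⊗[k] N →ₗ[k] A :=
  f ∘ₗ TensorProduct.map iT.toLinearMap iN.toLinearMap

/-- `f` is trivial on `N ⊗ T`: `f(n ⊗ t) = ε(n)ε(t)1`. -/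
def TrivialOnNT (iN : N →ₐc[k] H) (iT : T →ₐc[k] H) (f : H ⊗[k] H →ₗ[k] A) : Prop :=
  ∀ (n : N) (t : T), f (iN n ⊗ₜ[k] iT t)
    = algebraMap k A (Coalgebra.counit n * Coalgebra.counit t)

/-- `f` is trivial on `T ⊗ T`. -/
def TrivialOnTT (iT : T →ₐc[k] H) (f : H ⊗[k] H →ₗ[k] A) : Prop :=
  ∀ t t' : T, f (iT t ⊗ₜ[k] iT t')
    = algebraMap k A (Coalgebra.counit t * Coalgebra.counit t')

/-- `F` is the 2-cochain `ι f : (n ⋊ t) ⊗ (n' ⋊ t') ↦ ε(n) f(t)(n') ε(t')` on `H`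
associated with a measuring 1-cochain `f`. -/
def IotaOf (iN : N →ₐc[k] H) (iT : T →ₐc[k] H) (f : T ⊗[k] N →ₗ[k] A)
    (F : H ⊗[k] H →ₗ[k] A) : Prop :=
  ∀ (n : N) (t : T) (n' : N) (t' : T),
    F ((iN n * iT t) ⊗ₜ[k] (iN n' * iT t'))
      = algebraMap k A (Coalgebra.counit n * Coalgebra.counit t') * f (t ⊗ₜ[k] n')

/-- `J` is the 3-cochain
`jf : (n⋊t) ⊗ (n'⋊t') ⊗ (n''⋊t'') ↦ ε(n)ε(n') f(t⊗t')(n'') ε(t'')` on `H`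
associated with a measuring 2-cochain `f`. -/
def JOf (iN : N →ₐc[k] H) (iT : T →ₐc[k] H) (f : (T ⊗[k] T) ⊗[k] N →ₗ[k] A)
    (J : (H ⊗[k] H) ⊗[k] H →ₗ[k] A) : Prop :=
  ∀ (n : N) (t : T) (n' : N) (t' : T) (n'' : N) (t'' : T),
    J (((iN n * iT t) ⊗ₜ[k] (iN n' * iT t')) ⊗ₜ[k] (iN n'' * iT t''))
      = algebraMap k A (Coalgebra.counit n * Coalgebra.counit n' * Coalgebra.counit t'')
          * f ((t ⊗ₜ[k] t') ⊗ₜ[k] n'')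

end SmashStatements

end SmashPaper

open TensorProduct SmashPaper

namespace SmashPaper

section Conv

variable {k B C A : Type} [Field k] [AddCommGroup B] [Module k B] [Coalgebra k B]
  [AddCommGroup C] [Module k C] [Coalgebra k C] [CommRing A] [Algebra k A]

theorem conv_comp_coalgHom (f g : C →ₗ[k] A) (φ : B →ₗc[k] C) :
    conv f g ∘ₗ φ.toLinearMap = conv (f ∘ₗ φ.toLinearMap) (g ∘ₗ φ.toLinearMap) :=
  LinearMap.convMul_comp_coalgHom_distrib (WithConv.toConv f) (WithConv.toConv g) φ

theorem convOne_conv (f : C →ₗ[k] A) : conv (convOne C A) f = f :=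
  congrArg WithConv.ofConv (one_mul (WithConv.toConv f))

theorem conv_convOne (f : C →ₗ[k] A) : conv f (convOne C A) = f :=
  congrArg WithConv.ofConv (mul_one (WithConv.toConv f))

theorem conv_assoc (f g h : C →ₗ[k] A) : conv (conv f g) h = conv f (conv g h) :=
  congrArg WithConv.ofConv
    (mul_assoc (WithConv.toConv f) (WithConv.toConv g) (WithConv.toConv h))

theorem conv_comm [Coalgebra.IsCocomm k C] (f g : C →ₗ[k] A) : conv f g = conv g f :=
  congrArg WithConv.ofConv (mul_comm (WithConv.toConv f) (WithConv.toConv g))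

theorem IsCocomm.isCocomm (h : IsCocomm k C) : Coalgebra.IsCocomm k C := ⟨h⟩

end Conv

theorem sum_counit_right_smul {k C ι : Type} [Field k] [AddCommGroup C] [Module k C]
    [Coalgebra k C] {c : C} (r : Coalgebra.Repr k c ι) :
    ∑ i ∈ r.index, Coalgebra.counit (R := k) (r.right i) • r.left i = c := by
  simpa only [map_sum, TensorProduct.rid_tmul, one_smul] using
    congrArg (TensorProduct.rid k C) (Coalgebra.sum_tmul_counit_eq r)

section Drop

variable {k C D : Type} [Field k] [AddCommGroup C] [Module k C] [AddCommGroup D] [Module k D]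

@[simp]
theorem dropL_tmul [Coalgebra k C] (c : C) (d : D) :
    dropL (k := k) C D (c ⊗ₜ[k] d) = Coalgebra.counit (R := k) c • d := by
  simp [dropL]

@[simp]
theorem dropR_tmul [Coalgebra k D] (c : C) (d : D) :
    dropR (k := k) C D (c ⊗ₜ[k] d) = Coalgebra.counit (R := k) d • c := by
  simp [dropR]

/-- `dropL` as a coalgebra map. -/
noncomputable def dropLHom (k C D : Type) [Field k] [AddCommGroup C] [Module k C]
    [AddCommGroup D] [Module k D] [Coalgebra k C] [Coalgebra k D] : C ⊗[k] D →ₗc[k] D :=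
  (Coalgebra.TensorProduct.lid k D).toCoalgHom.comp
    (CoalgHom.rTensor D (Coalgebra.counitCoalgHom k C))

end Drop

section Smash

theorem toCoalgHom_apply {k B C : Type} [Field k] [Ring B] [Bialgebra k B] [Ring C] [Bialgebra k C]
    (φ : B →ₐc[k] C) (b : B) : φ.toCoalgHom b = φ b :=
  rfl

variable {k T N H A : Type} [Field k] [Ring T] [Bialgebra k T] [Ring N] [Bialgebra k N]
  [Ring H] [Bialgebra k H] [CommRing A] [Algebra k A]

@[simp]
theorem smashMul_tmul (iN : N →ₐc[k] H) (iT : T →ₐc[k] H) (n : N) (t : T) :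
    smashMul iN iT (n ⊗ₜ[k] t) = iN n * iT t :=
  rfl

/-- `smashMul` as a coalgebra map. -/
noncomputable def smashMulHom (iN : N →ₐc[k] H) (iT : T →ₐc[k] H) : N ⊗[k] T →ₗc[k] H :=
  (Bialgebra.mulCoalgHom k H).comp (Coalgebra.TensorProduct.map iN.toCoalgHom iT.toCoalgHom)

variable {iN : N →ₐc[k] H} {iT : T →ₐc[k] H} {f : H ⊗[k] H →ₗ[k] A}

theorem comp_rTensor_smashMul (hf : IsZ2 f) (hnorm : TrivialOnNT iN iT f) :
    f ∘ₗ LinearMap.rTensor H (smashMul iN iT)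
      = conv (C := (N ⊗[k] T) ⊗[k] H)
          (f ∘ₗ LinearMap.rTensor H (iT.toLinearMap ∘ₗ dropL N T))
          (f ∘ₗ TensorProduct.map iN.toLinearMap
                (LinearMap.mul' k H ∘ₗ LinearMap.rTensor H iT.toLinearMap)
             ∘ₗ (TensorProduct.assoc k N T H).toLinearMap) := by
  let φ : (N ⊗[k] T) ⊗[k] H →ₗc[k] (H ⊗[k] H) ⊗[k] H :=
    CoalgHom.rTensor H (Coalgebra.TensorProduct.map iN.toCoalgHom iT.toCoalgHom)
  have hφ (n : N) (t : T) (h : H) : φ ((n ⊗ₜ t) ⊗ₜ h) = (iN n ⊗ₜ iT t) ⊗ₜ h := rfl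
  have key := congrArg (· ∘ₗ φ.toLinearMap) hf.2.2
  simp only [cocycle2LHS, cocycle2RHS, conv_comp_coalgHom] at key
  have h1 : (f ∘ₗ dropR (H ⊗[k] H) H) ∘ₗ φ.toLinearMap = convOne ((N ⊗[k] T) ⊗[k] H) A := by
    refine TensorProduct.ext_threefold fun n t h => ?_
    simp [hφ, hnorm n t, convOne, Algebra.smul_def (A := A), mul_comm]
  rw [h1, convOne_conv] at key
  refine Eq.trans ?_ (key.trans ?_)
  · refine TensorProduct.ext_threefold fun n t h => ?_
    simp [hφ]
  congr 1
  · refine TensorProduct.ext_threefold fun n t h => ?_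
    simp [hφ, toCoalgHom_apply, ← TensorProduct.smul_tmul']
  · refine TensorProduct.ext_threefold fun n t h => ?_
    simp [hφ, toCoalgHom_apply]

theorem comp_lTensor_smashMul (hf : IsZ2 f) (hnorm : TrivialOnNT iN iT f) :
    f ∘ₗ LinearMap.lTensor H (smashMul iN iT)
      = conv (C := H ⊗[k] (N ⊗[k] T))
          (f ∘ₗ LinearMap.lTensor H (iN.toLinearMap ∘ₗ dropR N T))
          (f ∘ₗ TensorProduct.map
                (LinearMap.mul' k H ∘ₗ LinearMap.lTensor H iN.toLinearMap)
                iT.toLinearMap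
             ∘ₗ (TensorProduct.assoc k H N T).symm.toLinearMap) := by
  let φ : H ⊗[k] (N ⊗[k] T) →ₗc[k] (H ⊗[k] H) ⊗[k] H :=
    (Coalgebra.TensorProduct.assoc k k H H H).symm.toCoalgHom.comp
      (CoalgHom.lTensor H (Coalgebra.TensorProduct.map iN.toCoalgHom iT.toCoalgHom))
  have hφ (n : N) (t : T) (h : H) : φ (h ⊗ₜ (n ⊗ₜ t)) = (h ⊗ₜ iN n) ⊗ₜ iT t := rfl
  have key := congrArg (· ∘ₗ φ.toLinearMap) hf.2.2
  simp only [cocycle2LHS, cocycle2RHS, conv_comp_coalgHom] at key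
  have h1 : (f ∘ₗ dropL H (H ⊗[k] H) ∘ₗ (TensorProduct.assoc k H H H).toLinearMap)
      ∘ₗ φ.toLinearMap = convOne (H ⊗[k] (N ⊗[k] T)) A := by
    refine TensorProduct.ext <| LinearMap.ext fun h => TensorProduct.ext' fun n t => ?_
    simp [hφ, hnorm n t, convOne, Algebra.smul_def (A := A), mul_comm]
  rw [h1, convOne_conv] at key
  refine Eq.trans ?_ (key.symm.trans ?_)
  · refine TensorProduct.ext <| LinearMap.ext fun h => TensorProduct.ext' fun n t => ?_
    simp [hφ]
  · congr 1
    · refine TensorProduct.ext <| LinearMap.ext fun h => TensorProduct.ext' fun n t => ?_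
      simp [hφ, toCoalgHom_apply]
    · refine TensorProduct.ext <| LinearMap.ext fun h => TensorProduct.ext' fun n t => ?_
      simp [hφ, toCoalgHom_apply]

theorem apply_smash_tmul_right (hf : IsZ2 f) (hnorm : TrivialOnNT iN iT f) (n : N) (t t' : T) :
    f ((iN n * iT t) ⊗ₜ[k] iT t')
      = algebraMap k A (Coalgebra.counit n) * f (iT t ⊗ₜ[k] iT t') := by
  let φ : (N ⊗[k] T) ⊗[k] T →ₗc[k] (N ⊗[k] T) ⊗[k] H := CoalgHom.lTensor (N ⊗[k] T) iT.toCoalgHom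
  have hφ (n : N) (t t' : T) : φ ((n ⊗ₜ t) ⊗ₜ t') = (n ⊗ₜ t) ⊗ₜ iT t' := rfl
  have key := congrArg (· ∘ₗ φ.toLinearMap) (comp_rTensor_smashMul hf hnorm)
  simp only [conv_comp_coalgHom] at key
  have h1 : (f ∘ₗ TensorProduct.map iN.toLinearMap
                (LinearMap.mul' k H ∘ₗ LinearMap.rTensor H iT.toLinearMap)
             ∘ₗ (TensorProduct.assoc k N T H).toLinearMap) ∘ₗ φ.toLinearMap
      = convOne ((N ⊗[k] T) ⊗[k] T) A := by
    refine TensorProduct.ext_threefold fun n t t' => ?_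
    have := hnorm n (t * t')
    rw [map_mul] at this
    simp [hφ, toCoalgHom_apply, this, convOne, mul_comm, mul_assoc, mul_left_comm]
  rw [h1, conv_convOne] at key
  have := LinearMap.congr_fun key ((n ⊗ₜ t) ⊗ₜ t')
  simpa [hφ, toCoalgHom_apply, ← TensorProduct.smul_tmul', Algebra.smul_def (A := A)] using this

theorem apply_left_tmul_smash (hf : IsZ2 f) (hnorm : TrivialOnNT iN iT f) (n n' : N) (t' : T) :
    f (iN n ⊗ₜ[k] (iN n' * iT t'))
      = f (iN n ⊗ₜ[k] iN n') * algebraMap k A (Coalgebra.counit t') := by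
  let φ : N ⊗[k] (N ⊗[k] T) →ₗc[k] H ⊗[k] (N ⊗[k] T) := CoalgHom.rTensor (N ⊗[k] T) iN.toCoalgHom
  have hφ (n n' : N) (t' : T) : φ (n ⊗ₜ (n' ⊗ₜ t')) = iN n ⊗ₜ (n' ⊗ₜ t') := rfl
  have key := congrArg (· ∘ₗ φ.toLinearMap) (comp_lTensor_smashMul hf hnorm)
  simp only [conv_comp_coalgHom] at key
  have h1 : (f ∘ₗ TensorProduct.map
                (LinearMap.mul' k H ∘ₗ LinearMap.lTensor H iN.toLinearMap)
                iT.toLinearMap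
             ∘ₗ (TensorProduct.assoc k H N T).symm.toLinearMap) ∘ₗ φ.toLinearMap
      = convOne (N ⊗[k] (N ⊗[k] T)) A := by
    refine TensorProduct.ext <| LinearMap.ext fun n => TensorProduct.ext' fun n' t => ?_
    have := hnorm (n * n') t
    rw [map_mul] at this
    simp [hφ, toCoalgHom_apply, this, convOne, mul_comm, mul_left_comm]
  rw [h1, conv_convOne] at key
  have := LinearMap.congr_fun key (n ⊗ₜ (n' ⊗ₜ t'))
  simpa [hφ, toCoalgHom_apply, Algebra.smul_def (A := A), mul_comm] using this

variable {μ : T ⊗[k] N →ₗ[k] N}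

theorem IsSmashProduct.mul_eq (hsmash : IsSmashProduct μ iN iT) {t : T} {ι : Type}
    (r : Coalgebra.Repr k t ι) (n : N) :
    iT t * iN n = ∑ i ∈ r.index, iN (μ (r.left i ⊗ₜ n)) * iT (r.right i) := by
  have := LinearMap.congr_fun hsmash.straighten (t ⊗ₜ n)
  simpa [smashCross, ← r.eq, TensorProduct.sum_tmul] using this

theorem apply_mul_tmul_right (hsmash : IsSmashProduct μ iN iT) (hf : IsZ2 f)
    (hnorm : TrivialOnNT iN iT f) (t t' : T) (n : N) :
    f ((iT t * iN n) ⊗ₜ[k] iT t')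
      = algebraMap k A (Coalgebra.counit n) * f (iT t ⊗ₜ[k] iT t') := by
  let r := Coalgebra.Repr.arbitrary k t
  rw [hsmash.mul_eq r, TensorProduct.sum_tmul, map_sum]
  simp only [apply_smash_tmul_right hf hnorm, hsmash.act.counit_act]
  conv_rhs => rw [← Coalgebra.sum_counit_smul r]
  simp [TensorProduct.sum_tmul, ← TensorProduct.smul_tmul', Finset.mul_sum, Algebra.smul_def (A := A),
    mul_assoc, mul_left_comm]

theorem apply_left_tmul_mul_mul (hsmash : IsSmashProduct μ iN iT) (hf : IsZ2 f)
    (hnorm : TrivialOnNT iN iT f) (n n' : N) (t t' : T) :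
    f (iN n ⊗ₜ[k] (iT t * (iN n' * iT t')))
      = algebraMap k A (Coalgebra.counit t') * f (iN n ⊗ₜ[k] iN (μ (t ⊗ₜ n'))) := by
  let r := Coalgebra.Repr.arbitrary k t
  rw [← mul_assoc, hsmash.mul_eq r, Finset.sum_mul, TensorProduct.tmul_sum, map_sum]
  simp only [mul_assoc, ← map_mul iT, apply_left_tmul_smash hf hnorm]
  conv_rhs => rw [← sum_counit_right_smul r]
  simp [TensorProduct.sum_tmul, TensorProduct.tmul_sum, ← TensorProduct.smul_tmul',
    Finset.mul_sum, Algebra.smul_def (A := A), mul_comm, mul_assoc]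

/-- `f(t ⊗ n't') = ∑ f(t₍₁₎ ⊗ n') f(t₍₂₎ ⊗ t')`. -/
theorem comp_map_smashMul (hsmash : IsSmashProduct μ iN iT) (hf : IsZ2 f)
    (hnorm : TrivialOnNT iN iT f) :
    f ∘ₗ TensorProduct.map iT.toLinearMap (smashMul iN iT)
      = conv (C := T ⊗[k] (N ⊗[k] T))
          (f ∘ₗ TensorProduct.map iT.toLinearMap (iN.toLinearMap ∘ₗ dropR N T))
          (f ∘ₗ TensorProduct.map iT.toLinearMap (iT.toLinearMap ∘ₗ dropL N T)) := by
  let φ : T ⊗[k] (N ⊗[k] T) →ₗc[k] H ⊗[k] (N ⊗[k] T) := CoalgHom.rTensor (N ⊗[k] T) iT.toCoalgHom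
  have hφ (t : T) (n' : N) (t' : T) : φ (t ⊗ₜ (n' ⊗ₜ t')) = iT t ⊗ₜ (n' ⊗ₜ t') := rfl
  have key := congrArg (· ∘ₗ φ.toLinearMap) (comp_lTensor_smashMul hf hnorm)
  simp only [conv_comp_coalgHom] at key
  refine Eq.trans ?_ (key.trans ?_)
  · refine TensorProduct.ext <| LinearMap.ext fun t => TensorProduct.ext' fun n' t' => ?_
    simp [hφ, toCoalgHom_apply]
  · congr 1
    · refine TensorProduct.ext <| LinearMap.ext fun t => TensorProduct.ext' fun n' t' => ?_
      simp [hφ, toCoalgHom_apply]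
    · refine TensorProduct.ext <| LinearMap.ext fun t => TensorProduct.ext' fun n' t' => ?_
      simp [hφ, toCoalgHom_apply, apply_mul_tmul_right hsmash hf hnorm, Algebra.smul_def (A := A)]

theorem comp_map_smashMul_smashMul [Coalgebra.IsCocomm k T] [Coalgebra.IsCocomm k N]
    (hsmash : IsSmashProduct μ iN iT) (hf : IsZ2 f) (hnorm : TrivialOnNT iN iT f) :
    f ∘ₗ TensorProduct.map (smashMul iN iT) (smashMul iN iT)
      = conv (C := (N ⊗[k] T) ⊗[k] (N ⊗[k] T))
          (f ∘ₗ TensorProduct.map (iT.toLinearMap ∘ₗ dropL N T)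
                (iT.toLinearMap ∘ₗ dropL N T))
          (conv
            (f ∘ₗ TensorProduct.map (iT.toLinearMap ∘ₗ dropL N T)
                  (iN.toLinearMap ∘ₗ dropR N T))
            (f ∘ₗ TensorProduct.map iN.toLinearMap (iN.toLinearMap ∘ₗ μ)
               ∘ₗ (TensorProduct.assoc k N T N).toLinearMap
               ∘ₗ LinearMap.lTensor (N ⊗[k] T) (dropR N T))) := by
  let φ : (N ⊗[k] T) ⊗[k] (N ⊗[k] T) →ₗc[k] (N ⊗[k] T) ⊗[k] H :=
    CoalgHom.lTensor (N ⊗[k] T) (smashMulHom iN iT)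
  have hφ (n n' : N) (t t' : T) :
      φ ((n ⊗ₜ t) ⊗ₜ (n' ⊗ₜ t')) = (n ⊗ₜ t) ⊗ₜ (iN n' * iT t') := rfl
  let ψ : (N ⊗[k] T) ⊗[k] (N ⊗[k] T) →ₗc[k] T ⊗[k] (N ⊗[k] T) :=
    CoalgHom.rTensor (N ⊗[k] T) (dropLHom k N T)
  have hψ (n n' : N) (t t' : T) : ψ ((n ⊗ₜ t) ⊗ₜ (n' ⊗ₜ t'))
      = (Coalgebra.counit (R := k) n • t) ⊗ₜ (n' ⊗ₜ t') := rfl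
  have key := congrArg (· ∘ₗ φ.toLinearMap) (comp_rTensor_smashMul hf hnorm)
  have key' := congrArg (· ∘ₗ ψ.toLinearMap)
    ((comp_map_smashMul hsmash hf hnorm).trans (conv_comm _ _))
  simp only [conv_comp_coalgHom] at key key'
  rw [← conv_assoc]
  refine Eq.trans ?_ (key.trans ?_)
  · refine TensorProduct.ext_fourfold' fun n t n' t' => ?_
    simp [hφ]
  · congr 1
    · refine Eq.trans ?_ (key'.trans ?_)
      · refine TensorProduct.ext_fourfold' fun n t n' t' => ?_
        simp [hφ, toCoalgHom_apply, hψ]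
      · congr 1
        · refine TensorProduct.ext_fourfold' fun n t n' t' => ?_
          simp [hψ, toCoalgHom_apply, ← TensorProduct.smul_tmul',
            smul_comm (Coalgebra.counit (R := k) n)]
        · refine TensorProduct.ext_fourfold' fun n t n' t' => ?_
          simp [hψ, toCoalgHom_apply, ← TensorProduct.smul_tmul',
            smul_comm (Coalgebra.counit (R := k) n)]
    · refine TensorProduct.ext_fourfold' fun n t n' t' => ?_
      simp [hφ, toCoalgHom_apply, apply_left_tmul_mul_mul hsmash hf hnorm, Algebra.smul_def (A := A)]

end Smash

end SmashPaper

/-- **Corollary (identities for normalized 2-cocycles on a smash product).**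
Let `H = N ⋊ T` (cocommutative Hopf algebras over `k`) act trivially on the commutative
`k`-algebra `A`, and let `f : H ⊗ H → A` be a normalized Sweedler 2-cocycle
(trivial on `N ⊗ T`).  Then, for all `n, n' ∈ N`, `t, t' ∈ T`, `h, h' ∈ H`:

1. `f(nt ⊗ h') = ∑ f(t₍₁₎ ⊗ h'₍₁₎) f(n ⊗ t₍₂₎h'₍₂₎)`;
2. `f(nt ⊗ t') = ε(n) f(t ⊗ t')`;
3. `f(h ⊗ n't') = ∑ f(h₍₁₎ ⊗ n'₍₁₎) f(h₍₂₎n'₍₂₎ ⊗ t')`;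
4. `f(n ⊗ n't') = f(n ⊗ n') ε(t')`;
5. `f(nt ⊗ n't') = ∑ f(t₍₁₎ ⊗ t') f(t₍₂₎ ⊗ n'₍₁₎) f(n ⊗ t₍₃₎(n'₍₂₎))`.

Equations with Sweedler sums are stated as identities of linear maps, using the
convolution encoding of Sweedler indices, with elements `n ⋊ t` of `H` represented
as `(iN n) * (iT t)`. -/
theorem normalized_cocycle_identities
    {k : Type} [Field k] {T N H A : Type}
    [Ring T] [HopfAlgebra k T] [Ring N] [HopfAlgebra k N]
    [Ring H] [HopfAlgebra k H] [CommRing A] [Algebra k A]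
    (hTcc : IsCocomm k T) (hNcc : IsCocomm k N)
    (μ : T ⊗[k] N →ₗ[k] N) (iN : N →ₐc[k] H) (iT : T →ₐc[k] H)
    (hsmash : IsSmashProduct μ iN iT)
    (f : H ⊗[k] H →ₗ[k] A) (hf : IsZ2 f) (hnorm : TrivialOnNT iN iT f) :
    -- (1)  f(nt ⊗ h') = ∑ f(t₍₁₎ ⊗ h'₍₁₎) f(n ⊗ t₍₂₎h'₍₂₎)
    (f ∘ₗ LinearMap.rTensor H (smashMul iN iT)
      = conv (C := (N ⊗[k] T) ⊗[k] H)
          (f ∘ₗ LinearMap.rTensor H (iT.toLinearMap ∘ₗ dropL N T))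
          (f ∘ₗ TensorProduct.map iN.toLinearMap
                (LinearMap.mul' k H ∘ₗ LinearMap.rTensor H iT.toLinearMap)
             ∘ₗ (TensorProduct.assoc k N T H).toLinearMap))
    -- (2)  f(nt ⊗ t') = ε(n) f(t ⊗ t')
    ∧ (∀ (n : N) (t t' : T),
        f ((iN n * iT t) ⊗ₜ[k] iT t')
          = algebraMap k A (Coalgebra.counit n) * f (iT t ⊗ₜ[k] iT t'))
    -- (3)  f(h ⊗ n't') = ∑ f(h₍₁₎ ⊗ n'₍₁₎) f(h₍₂₎n'₍₂₎ ⊗ t')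
    ∧ (f ∘ₗ LinearMap.lTensor H (smashMul iN iT)
      = conv (C := H ⊗[k] (N ⊗[k] T))
          (f ∘ₗ LinearMap.lTensor H (iN.toLinearMap ∘ₗ dropR N T))
          (f ∘ₗ TensorProduct.map
                (LinearMap.mul' k H ∘ₗ LinearMap.lTensor H iN.toLinearMap)
                iT.toLinearMap
             ∘ₗ (TensorProduct.assoc k H N T).symm.toLinearMap))
    -- (4)  f(n ⊗ n't') = f(n ⊗ n') ε(t')
    ∧ (∀ (n n' : N) (t' : T),
        f (iN n ⊗ₜ[k] (iN n' * iT t'))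
          = f (iN n ⊗ₜ[k] iN n') * algebraMap k A (Coalgebra.counit t'))
    -- (5)  f(nt ⊗ n't') = ∑ f(t₍₁₎ ⊗ t') f(t₍₂₎ ⊗ n'₍₁₎) f(n ⊗ t₍₃₎(n'₍₂₎))
    ∧ (f ∘ₗ TensorProduct.map (smashMul iN iT) (smashMul iN iT)
      = conv (C := (N ⊗[k] T) ⊗[k] (N ⊗[k] T))
          (f ∘ₗ TensorProduct.map (iT.toLinearMap ∘ₗ dropL N T)
                (iT.toLinearMap ∘ₗ dropL N T))
          (conv
            (f ∘ₗ TensorProduct.map (iT.toLinearMap ∘ₗ dropL N T)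
                  (iN.toLinearMap ∘ₗ dropR N T))
            (f ∘ₗ TensorProduct.map iN.toLinearMap (iN.toLinearMap ∘ₗ μ)
               ∘ₗ (TensorProduct.assoc k N T N).toLinearMap
               ∘ₗ LinearMap.lTensor (N ⊗[k] T) (dropR N T)))) := by
  have := hTcc.isCocomm
  have := hNcc.isCocomm
  exact ⟨comp_rTensor_smashMul hf hnorm, apply_smash_tmul_right hf hnorm,
    comp_lTensor_smashMul hf hnorm, apply_left_tmul_smash hf hnorm,
    comp_map_smashMul_smashMul hsmash hf hnorm⟩
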